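/- The Levi graph of the 3×3×3 grid configuration is Hamiltonian: it contains a Hamiltonian cycle, i.e. a cycle visiting every one of its 54 vertices exactly once. -/

import Mathlib

def otherCoords (p : Fin 3 × Fin 3 × Fin 3) (k : Fin 3) : Fin 3 × Fin 3 :=
  if k = 0 then (p.2.1, p.2.2) else if k = 1 then (p.1, p.2.2) else (p.1, p.2.1)

def gridLevi : SimpleGraph ((Fin 3 × Fin 3 × Fin 3) ⊕ (Fin 3 × Fin 3 × Fin 3)) :=
  SimpleGraph.fromRel (fun x y =>
    match x, y with
    | Sum.inl p, Sum.inr l => otherCoords p l.1 = (l.2.1, l.2.2)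
    | _, _ => False)

/-- A list without repetitions that is as long as the number of vertices and whose cyclically
consecutive entries are adjacent gives a Hamiltonian cycle. -/
theorem SimpleGraph.exists_isHamiltonianCycle_of_isChain {V : Type*} [DecidableEq V]
    [Fintype V] {G : SimpleGraph V} {u : V} {l : List V}
    (hchain : (u :: l).IsChain G.Adj)
    (hlast : (u :: l).getLast (l.cons_ne_nil u) = u) (hnodup : l.Nodup)
    (hlength : l.length = Fintype.card V) (hcard : 3 ≤ Fintype.card V) :
    ∃ (v : V) (c : G.Walk v v), c.IsHamiltonianCycle := by
  let c : G.Walk u u := (Walk.ofSupport (u :: l) (l.cons_ne_nil u) hchain).copy rfl hlast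
  have hsupport : c.support = u :: l :=
    (Walk.support_copy _ _ _).trans (Walk.support_ofSupport _ hchain)
  have hc : c.length = l.length := by
    simpa [hsupport] using c.length_support.symm
  have hnil : ¬ c.Nil := by
    rw [← Walk.length_eq_zero_iff]
    omega
  have htail : c.tail.support = l := by
    rw [Walk.support_tail_of_not_nil _ hnil, hsupport, List.tail_cons]
  have hpath : c.tail.IsPath := Walk.IsPath.mk' (htail ▸ hnodup)
  refine ⟨u, c, Walk.isCycle_iff_isPath_tail_and_le_length.2 ⟨hpath, by omega⟩,
    Walk.isHamiltonian_iff_isPath_and_length_eq.2 ⟨hpath, ?_⟩⟩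
  have := c.tail.length_support
  rw [htail] at this
  omega

instance : DecidableRel gridLevi.Adj := fun x y =>
  match x, y with
  | Sum.inl p, Sum.inr l =>
    decidable_of_iff (otherCoords p l.1 = (l.2.1, l.2.2)) (by simp [gridLevi])
  | Sum.inr l, Sum.inl p =>
    decidable_of_iff (otherCoords p l.1 = (l.2.1, l.2.2)) (by simp [gridLevi])
  | Sum.inl _, Sum.inl _ => isFalse (by simp [gridLevi])
  | Sum.inr _, Sum.inr _ => isFalse (by simp [gridLevi])

/-- A path of nine points from `(0, 0, 0)` towards `(1, 1, 1)`, each paired with the axis direction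
of the line joining it to the next one. The points represent the orbits of the translation by
`(1, 1, 1)`. -/
def gridLeviArc : List ((Fin 3 × Fin 3 × Fin 3) × Fin 3) :=
  [((0, 0, 0), 0), ((1, 0, 0), 1), ((1, 1, 0), 0), ((0, 1, 0), 1), ((0, 2, 0), 2),
    ((0, 2, 1), 1), ((0, 1, 1), 2), ((0, 1, 2), 0), ((1, 1, 2), 2)]

/-- The vertices of a Hamiltonian cycle, starting after the line in direction `2` through
`(0, 0, 0)` and ending with that line: the translates of `gridLeviArc` by multiples of
`(1, 1, 1)`. -/
def gridLeviCycle : List ((Fin 3 × Fin 3 × Fin 3) ⊕ (Fin 3 × Fin 3 × Fin 3)) :=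
  (List.finRange 3).flatMap fun t => gridLeviArc.flatMap fun (p, k) =>
    [Sum.inl (p + (t, t, t)), Sum.inr (k, otherCoords (p + (t, t, t)) k)]

theorem grid_levi_hamiltonian :
    ∃ (v : (Fin 3 × Fin 3 × Fin 3) ⊕ (Fin 3 × Fin 3 × Fin 3)) (c : gridLevi.Walk v v),
      c.IsHamiltonianCycle := by
  exact SimpleGraph.exists_isHamiltonianCycle_of_isChain (u := Sum.inr (2, 0, 0))
    (l := gridLeviCycle) (by decide +kernel) (by decide +kernel) (by decide +kernel)
    (by decide +kernel) (by decide +kernel)
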